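/- arXiv:2605.24802 — 3 statements merged into one kernel-verified Lean document; each statement's English description precedes it below -/
import Mathlib

section
/- Let N ≥ 3 be an integer and K(x) = exp(|x|²/4) for x ∈ ℝ^N. For every u ∈ C_c^∞(ℝ^N) one has the weighted Hardy inequality ∫_{ℝ^N} (|u(x)|²/|x|²) K(x) dx ≤ (2/(N−2))² ∫_{ℝ^N} |∇u(x)|² K(x) dx. In particular, ∫_{ℝ^N} (|u|²/|x|²) K dx is finite whenever ∫_{ℝ^N} |∇u|² K dx is finite. -/
open MeasureTheory Real Set

noncomputable section

abbrev Euc (N : ℕ) := EuclideanSpace ℝ (Fin N)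

def Kw {N : ℕ} (x : Euc N) : ℝ := Real.exp (‖x‖ ^ 2 / 4)

def twoStar (N : ℕ) : ℝ := 2 * N / ((N : ℝ) - 2)

structure MemX {N : ℕ} (v : Euc N → ℝ) : Prop where
  diff : Differentiable ℝ v
  int_grad : Integrable fun x => ‖gradient v x‖ ^ 2 * Kw x
  int_sq : Integrable fun x => v x ^ 2 * Kw x
  int_hardy : Integrable fun x => v x ^ 2 / ‖x‖ ^ 2 * Kw x
  int_crit : Integrable fun x => |v x| ^ twoStar N * Kw x

def Afun {N : ℕ} (μ : ℝ) (v : Euc N → ℝ) : ℝ :=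
  ∫ x, (‖gradient v x‖ ^ 2 - μ * v x ^ 2 / ‖x‖ ^ 2 - ((N : ℝ) - 2) / 4 * v x ^ 2) * Kw x

def Bfun {N : ℕ} (v : Euc N → ℝ) : ℝ := ∫ x, |v x| ^ twoStar N * Kw x

def EKf {N : ℕ} (μ : ℝ) (v : Euc N → ℝ) : ℝ := Afun μ v / 2 - Bfun v / twoStar N

def DK {N : ℕ} (μ : ℝ) (v : Euc N → ℝ) : ℝ := Afun μ v - Bfun v

def DKd {N : ℕ} (μ δ : ℝ) (v : Euc N → ℝ) : ℝ := δ * Afun μ v - Bfun v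

def normKp1Sq {N : ℕ} (v : Euc N → ℝ) : ℝ := Bfun v ^ (2 / twoStar N)

def SK (N : ℕ) (μ : ℝ) : ℝ :=
  sInf { r | ∃ v : Euc N → ℝ, MemX v ∧ v ≠ 0 ∧ r = Afun μ v / normKp1Sq v }

def rdel (N : ℕ) (μ δ : ℝ) : ℝ := δ ^ (((N : ℝ) - 2) / 2) * SK N μ ^ ((N : ℝ) / 2)

def gradNormSq {N : ℕ} (v : Euc N → ℝ) : ℝ := ∫ x, ‖gradient v x‖ ^ 2 * Kw x

def normKsq {N : ℕ} (v : Euc N → ℝ) : ℝ := ∫ x, v x ^ 2 * Kw x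

def ddepth (N : ℕ) (μ δ : ℝ) : ℝ :=
  sInf { e | ∃ v : Euc N → ℝ, MemX v ∧ DKd μ δ v = 0 ∧ gradNormSq v ≠ 0 ∧ e = EKf μ v }

def dwell (N : ℕ) (μ : ℝ) : ℝ :=
  sInf { e | ∃ v : Euc N → ℝ, MemX v ∧ v ≠ 0 ∧ DK μ v = 0 ∧ e = EKf μ v }

open Filter Topology

section

variable {E : Type*} [NormedAddCommGroup E] [InnerProductSpace ℝ E] [FiniteDimensional ℝ E]
  [MeasurableSpace E] [BorelSpace E]

/-- The Euler vector field `x ↦ x` is, up to sign, dual to multiplication by the dimension. -/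
theorem integral_fderiv_apply_self {w : E → ℝ} (hw : ContDiff ℝ 1 w) (hc : HasCompactSupport w) :
    ∫ x, fderiv ℝ w x x = -(Module.finrank ℝ E * ∫ x, w x) := by
  set b := stdOrthonormalBasis ℝ E
  have hdw : Continuous (fderiv ℝ w) := hw.continuous_fderiv one_ne_zero
  have hcoord (i) (x : E) : fderiv ℝ (fun y => innerSL ℝ (b i) y) x = innerSL ℝ (b i) :=
    (innerSL ℝ (b i)).fderiv
  have hint (i) : Integrable fun x => innerSL ℝ (b i) x * fderiv ℝ w x (b i) := by
    refine Continuous.integrable_of_hasCompactSupport (by fun_prop) ?_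
    exact (hc.fderiv_apply ℝ (b i)).mul_left
  have hparts (i) : ∫ x, innerSL ℝ (b i) x * fderiv ℝ w x (b i) = -∫ x, w x := by
    rw [integral_mul_fderiv_eq_neg_fderiv_mul_of_integrable _ (hint i)]
    · simp_rw [hcoord]
      simp
    · exact Continuous.integrable_of_hasCompactSupport
        ((innerSL ℝ (b i)).continuous.mul hw.continuous) hc.mul_left
    · exact fun x _ => (innerSL ℝ (b i)).differentiableAt
    · exact fun x _ => hw.differentiable one_ne_zero x
    · simp_rw [hcoord]
      simpa using hw.continuous.integrable_of_hasCompactSupport hc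
  have hsum (x : E) : fderiv ℝ w x x = ∑ i, innerSL ℝ (b i) x * fderiv ℝ w x (b i) := by
    conv_lhs => rw [← b.sum_repr' x, map_sum]
    simp [b.sum_repr']
  simp_rw [hsum]
  rw [integral_finsetSum _ fun i _ => hint i]
  simp_rw [hparts]
  simp

end

theorem hasDerivAt_exp_div_add {ε s : ℝ} (hs : s + ε ≠ 0) :
    HasDerivAt (fun s => Real.exp (s / 4) / (s + ε))
      (Real.exp (s / 4) * (1 / (4 * (s + ε)) - 1 / (s + ε) ^ 2)) s := by
  have h := (((hasDerivAt_id s).div_const 4).exp).div ((hasDerivAt_id s).add_const ε) hs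
  refine h.congr_deriv ?_
  simp only [id]
  field_simp

theorem continuous_Kw {N : ℕ} : Continuous (Kw (N := N)) := by
  unfold Kw
  fun_prop

theorem Kw_pos {N : ℕ} (x : Euc N) : 0 < Kw x := Real.exp_pos _

theorem contDiff_regularizedWeight {N : ℕ} {ε : ℝ} (hε : 0 < ε) :
    ContDiff ℝ 1 fun x : Euc N => Kw x / (‖x‖ ^ 2 + ε) := by
  unfold Kw
  have h : ContDiff ℝ 1 fun x : Euc N => ‖x‖ ^ 2 := contDiff_norm_sq ℝ
  exact (h.div_const 4).exp.div (h.add contDiff_const) fun x => by positivity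

theorem fderiv_regularizedWeight_apply_self {N : ℕ} {ε : ℝ} (hε : 0 < ε) (x : Euc N) :
    fderiv ℝ (fun x : Euc N => Kw x / (‖x‖ ^ 2 + ε)) x x =
      Kw x * (1 / (4 * (‖x‖ ^ 2 + ε)) - 1 / (‖x‖ ^ 2 + ε) ^ 2) * (2 * ‖x‖ ^ 2) := by
  have h := (hasDerivAt_exp_div_add (ε := ε) (s := ‖x‖ ^ 2) (by positivity)).comp_hasFDerivAt x
    (hasStrictFDerivAt_norm_sq x).hasFDerivAt
  have h' := h.fderiv
  simp only [Function.comp_def] at h'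
  unfold Kw
  rw [h']
  simp

theorem norm_gradient_eq {N : ℕ} (u : Euc N → ℝ) (x : Euc N) :
    ‖gradient u x‖ = ‖fderiv ℝ u x‖ := by
  simp [gradient]

/-- Pointwise form of the regularized Hardy inequality: the right side is the divergence of
`w x • x` with `w = u ^ 2 * Kw / (‖x‖ ^ 2 + ε)`. -/
theorem hardy_divergence_lower_bound {N : ℕ} (hN : 3 ≤ N) {u : Euc N → ℝ}
    (hu : Differentiable ℝ u) {ε : ℝ} (hε : 0 < ε) (x : Euc N) :
    ((N : ℝ) - 2) / 2 * (u x ^ 2 * (Kw x / (‖x‖ ^ 2 + ε))) -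
        2 / ((N : ℝ) - 2) * (‖gradient u x‖ ^ 2 * Kw x) ≤
      fderiv ℝ (fun x => u x ^ 2 * (Kw x / (‖x‖ ^ 2 + ε))) x x +
        N * (u x ^ 2 * (Kw x / (‖x‖ ^ 2 + ε))) := by
  have hw := (contDiff_regularizedWeight (N := N) hε).differentiable one_ne_zero x
  have hN' : (3 : ℝ) ≤ N := by exact_mod_cast hN
  have hfd : fderiv ℝ (fun x => u x ^ 2 * (Kw x / (‖x‖ ^ 2 + ε))) x x =
      u x ^ 2 * (Kw x * (1 / (4 * (‖x‖ ^ 2 + ε)) - 1 / (‖x‖ ^ 2 + ε) ^ 2) * (2 * ‖x‖ ^ 2)) +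
        Kw x / (‖x‖ ^ 2 + ε) * (2 * u x * fderiv ℝ u x x) := by
    rw [fderiv_fun_mul ((hu x).fun_pow 2) hw]
    simp [fderiv_regularizedWeight_apply_self hε, fderiv_fun_pow 2 (hu x)]
  rw [hfd, norm_gradient_eq]
  have hd := (fderiv ℝ u x).le_opNorm x
  rw [Real.norm_eq_abs] at hd
  set r := ‖x‖
  set d := fderiv ℝ u x x
  set g := ‖fderiv ℝ u x‖
  set c : ℝ := N - 2 with hc
  have hNc : (N : ℝ) = c + 2 := by rw [hc]; ring
  have hcpos : 0 < c := by linarith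
  have hK := Kw_pos x
  have hq : 0 < r ^ 2 + ε := by positivity
  have hd2 : d ^ 2 ≤ g ^ 2 * r ^ 2 := by
    rw [← mul_pow, ← sq_abs d]; gcongr
  have hdg : d ^ 2 / (r ^ 2 + ε) ≤ g ^ 2 := by
    rw [div_le_iff₀ hq]
    nlinarith [sq_nonneg g]
  have hyoung : 0 ≤ c / 2 * u x ^ 2 + 2 * u x * d + 2 / c * d ^ 2 := by
    have : c / 2 * u x ^ 2 + 2 * u x * d + 2 / c * d ^ 2 = (c * u x + 2 * d) ^ 2 / (2 * c) := by
      field_simp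
      ring
    rw [this]
    positivity
  have h1 : 0 ≤ Kw x / (r ^ 2 + ε) * (c / 2 * u x ^ 2 + 2 * u x * d + 2 / c * d ^ 2) := by
    positivity
  have h2 : 0 ≤ Kw x * (2 / c) * (g ^ 2 - d ^ 2 / (r ^ 2 + ε)) := by
    have := sub_nonneg.2 hdg
    positivity
  have h3 : 0 ≤ u x ^ 2 * Kw x * (r ^ 2 / (2 * (r ^ 2 + ε)) + 2 * ε / (r ^ 2 + ε) ^ 2) := by
    positivity
  rw [hNc]
  have key : u x ^ 2 * (Kw x * (1 / (4 * (r ^ 2 + ε)) - 1 / (r ^ 2 + ε) ^ 2) * (2 * r ^ 2)) +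
        Kw x / (r ^ 2 + ε) * (2 * u x * d) + (c + 2) * (u x ^ 2 * (Kw x / (r ^ 2 + ε))) -
      (c / 2 * (u x ^ 2 * (Kw x / (r ^ 2 + ε))) - 2 / c * (g ^ 2 * Kw x)) =
      Kw x / (r ^ 2 + ε) * (c / 2 * u x ^ 2 + 2 * u x * d + 2 / c * d ^ 2) +
      Kw x * (2 / c) * (g ^ 2 - d ^ 2 / (r ^ 2 + ε)) +
      u x ^ 2 * Kw x * (r ^ 2 / (2 * (r ^ 2 + ε)) + 2 * ε / (r ^ 2 + ε) ^ 2) := by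
    field_simp
    ring
  linarith

theorem integrable_gradient_sq_mul_Kw {N : ℕ} {u : Euc N → ℝ} (hu : ContDiff ℝ 1 u)
    (hsupp : HasCompactSupport u) : Integrable fun x => ‖gradient u x‖ ^ 2 * Kw x := by
  simp_rw [norm_gradient_eq]
  have hdu := hu.continuous_fderiv one_ne_zero
  refine Continuous.integrable_of_hasCompactSupport ((hdu.norm.pow 2).mul continuous_Kw) ?_
  exact ((hsupp.fderiv ℝ).comp_left (g := fun L => ‖L‖ ^ 2) (by simp)).mul_right

/-- The Hardy inequality with the singular weight `‖x‖⁻²` replaced by `(‖x‖ ^ 2 + ε)⁻¹`. -/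
theorem weighted_hardy_regularized {N : ℕ} (hN : 3 ≤ N) {u : Euc N → ℝ} (hu : ContDiff ℝ 1 u)
    (hsupp : HasCompactSupport u) {ε : ℝ} (hε : 0 < ε) :
    Integrable (fun x => u x ^ 2 * (Kw x / (‖x‖ ^ 2 + ε))) ∧
    ∫ x, u x ^ 2 * (Kw x / (‖x‖ ^ 2 + ε)) ≤
      (2 / ((N : ℝ) - 2)) ^ 2 * ∫ x, ‖gradient u x‖ ^ 2 * Kw x := by
  have hN' : (3 : ℝ) ≤ N := by exact_mod_cast hN
  have hw : ContDiff ℝ 1 fun x => u x ^ 2 * (Kw x / (‖x‖ ^ 2 + ε)) :=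
    (hu.pow 2).mul (contDiff_regularizedWeight hε)
  have hwc : HasCompactSupport fun x => u x ^ 2 * (Kw x / (‖x‖ ^ 2 + ε)) :=
    (hsupp.comp_left (g := fun t => t ^ 2) (by simp)).mul_right
  have hwi := hw.continuous.integrable_of_hasCompactSupport (μ := volume) hwc
  have hgi := integrable_gradient_sq_mul_Kw hu hsupp
  have hdi : Integrable fun x =>
      fderiv ℝ (fun x => u x ^ 2 * (Kw x / (‖x‖ ^ 2 + ε))) x x := by
    have hcont := (hw.continuous_fderiv one_ne_zero).clm_apply continuous_id
    refine hcont.integrable_of_hasCompactSupport ?_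
    exact (hwc.fderiv ℝ).mono fun x hx h => hx (by simp [h])
  have hmono := integral_mono ((hwi.const_mul (((N : ℝ) - 2) / 2)).sub
    (hgi.const_mul (2 / ((N : ℝ) - 2)))) (hdi.add (hwi.const_mul (N : ℝ)))
    fun x => hardy_divergence_lower_bound hN (hu.differentiable one_ne_zero) hε x
  simp only [Pi.sub_apply, Pi.add_apply] at hmono
  rw [integral_sub (hwi.const_mul _) (hgi.const_mul _), integral_add hdi (hwi.const_mul _),
    integral_fderiv_apply_self hw hwc] at hmono
  simp only [integral_const_mul, finrank_euclideanSpace, Fintype.card_fin, neg_add_cancel]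
    at hmono
  refine ⟨hwi, ?_⟩
  have hc : 0 < (N : ℝ) - 2 := by linarith
  generalize (∫ x, u x ^ 2 * (Kw x / (‖x‖ ^ 2 + ε))) = I at hmono ⊢
  generalize (∫ x, ‖gradient u x‖ ^ 2 * Kw x) = G at hmono ⊢
  have h := mul_nonpos_of_nonneg_of_nonpos (by positivity : 0 ≤ 2 / ((N : ℝ) - 2)) hmono
  have h' : 2 / ((N : ℝ) - 2) * (((N : ℝ) - 2) / 2 * I - 2 / ((N : ℝ) - 2) * G) =
      I - (2 / ((N : ℝ) - 2)) ^ 2 * G := by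
    field_simp
  linarith

/-- A form of Fatou's lemma for nonnegative functions with uniformly bounded integrals. -/
theorem integrable_and_integral_le_of_tendsto {α : Type*} [MeasurableSpace α] {μ : Measure α}
    {F : ℕ → α → ℝ} {f : α → ℝ} {C : ℝ} (hF : ∀ n, Integrable (F n) μ)
    (hF0 : ∀ n, 0 ≤ᵐ[μ] F n) (hFC : ∀ n, ∫ x, F n x ∂μ ≤ C)
    (hlim : ∀ᵐ x ∂μ, Tendsto (fun n => F n x) atTop (𝓝 (f x))) :
    Integrable f μ ∧ ∫ x, f x ∂μ ≤ C := by
  have hC : 0 ≤ C := (integral_nonneg_of_ae (hF0 0)).trans (hFC 0)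
  have hfm : AEStronglyMeasurable f μ :=
    aestronglyMeasurable_of_tendsto_ae atTop (fun n => (hF n).aestronglyMeasurable) hlim
  have hf0 : 0 ≤ᵐ[μ] f := by
    filter_upwards [hlim, ae_all_iff.2 hF0] with x hx h0
    exact ge_of_tendsto' hx h0
  have hle : ∫⁻ x, ENNReal.ofReal (f x) ∂μ ≤ ENNReal.ofReal C := calc
    ∫⁻ x, ENNReal.ofReal (f x) ∂μ = ∫⁻ x, liminf (fun n => ENNReal.ofReal (F n x)) atTop ∂μ := by
      refine lintegral_congr_ae (hlim.mono fun x hx => ?_)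
      exact (ENNReal.tendsto_ofReal hx).liminf_eq.symm
    _ ≤ liminf (fun n => ∫⁻ x, ENNReal.ofReal (F n x) ∂μ) atTop :=
      lintegral_liminf_le' fun n => (hF n).aemeasurable.ennreal_ofReal
    _ ≤ ENNReal.ofReal C := by
      refine liminf_le_of_le (by isBoundedDefault) fun b hb => ?_
      obtain ⟨n, hn⟩ := hb.exists
      rw [← ofReal_integral_eq_lintegral_ofReal (hF n) (hF0 n)] at hn
      exact hn.trans (ENNReal.ofReal_le_ofReal (hFC n))
  have hfi : Integrable f μ :=
    (lintegral_ofReal_ne_top_iff_integrable hfm hf0).1 (hle.trans_lt ENNReal.ofReal_lt_top).ne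
  refine ⟨hfi, ?_⟩
  rwa [← ofReal_integral_eq_lintegral_ofReal hfi hf0, ENNReal.ofReal_le_ofReal_iff hC] at hle

/-- weighted Hardy inequality for smooth compactly supported functions. -/
theorem weighted_hardy_inequality (N : ℕ) (hN : 3 ≤ N)
    (u : Euc N → ℝ) (hu : ContDiff ℝ (⊤ : ℕ∞) u) (hsupp : HasCompactSupport u) :
    Integrable (fun x : Euc N => u x ^ 2 / ‖x‖ ^ 2 * Kw x) ∧
    ∫ x : Euc N, u x ^ 2 / ‖x‖ ^ 2 * Kw x ≤
      (2 / ((N : ℝ) - 2)) ^ 2 * ∫ x : Euc N, ‖gradient u x‖ ^ 2 * Kw x := by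
  have : Nonempty (Fin N) := ⟨⟨0, by omega⟩⟩
  have hu1 : ContDiff ℝ 1 u := hu.of_le (by exact_mod_cast le_top)
  have hreg (n : ℕ) := weighted_hardy_regularized hN hu1 hsupp (Nat.one_div_pos_of_nat (n := n))
  refine integrable_and_integral_le_of_tendsto (fun n => (hreg n).1)
    (fun n => ae_of_all _ fun x => ?_) (fun n => (hreg n).2) ?_
  · have := Kw_pos x
    positivity
  · filter_upwards [Measure.ae_ne volume (0 : Euc N)] with x hx
    have hx' : ‖x‖ ^ 2 + 0 ≠ 0 := by simpa using hx
    have h := ((tendsto_const_nhds (x := Kw x)).div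
      ((tendsto_const_nhds (x := ‖x‖ ^ 2)).add (tendsto_one_div_add_atTop_nhds_zero_nat (𝕜 := ℝ)))
      hx').const_mul (u x ^ 2)
    have hx0 : u x ^ 2 / ‖x‖ ^ 2 * Kw x = u x ^ 2 * (Kw x / (‖x‖ ^ 2 + 0)) := by ring
    rw [hx0]
    exact h
end
end

section
/- Let N ≥ 3, K(y) = exp(|y|²/4), β = (N−2)/4, and μ ∈ [0, (N−2)²/8]. Then for every v in X one has A(v) ≥ (1/4) ∫_{ℝ^N} |v|² K(y) dy. -/
open MeasureTheory Real Set

noncomputable section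

/-- The integral of `h` over a Euclidean space is nonnegative if its radial integral over almost
every ray is nonnegative. Integrability along almost every ray may be used both for `h` and for a
second integrable function `k`. -/
lemma integral_nonneg_of_rays {N : ℕ} (hN : 1 ≤ N) {h k : Euc N → ℝ}
    (hh : Integrable h) (hk : Integrable k)
    (H : ∀ ω : Euc N, ‖ω‖ = 1 →
      IntegrableOn (fun r : ℝ => r ^ (N - 1) * h (r • ω)) (Ioi 0) →
      IntegrableOn (fun r : ℝ => r ^ (N - 1) * k (r • ω)) (Ioi 0) →
      0 ≤ ∫ r in Ioi (0 : ℝ), r ^ (N - 1) * h (r • ω)) :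
    0 ≤ ∫ x, h x := by
  have : Nontrivial (Euc N) :=
    Module.nontrivial_of_finrank_pos (R := ℝ)
    (by rw [finrank_euclideanSpace_fin]; omega)
  set μ : Measure (Euc N) := volume
  have hdim : Module.finrank ℝ (Euc N) = N := by simp
  have hmp := μ.measurePreserving_homeomorphUnitSphereProd
  have hemb := (homeomorphUnitSphereProd (Euc N)).measurableEmbedding
  rw [hdim] at hmp
  have hpolar : ∀ f : Euc N → ℝ, Integrable f →
      Integrable (fun p : Metric.sphere (0 : Euc N) 1 × Ioi (0 : ℝ) => f ((p.2 : ℝ) • (p.1 : Euc N)))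
        (μ.toSphere.prod (Measure.volumeIoiPow (N - 1))) := by
    intro f hf
    rw [← hmp.integrable_comp_emb hemb]
    have h1 : IntegrableOn f {0}ᶜ μ := hf.integrableOn
    rw [integrableOn_iff_comap_subtypeVal (measurableSet_singleton _).compl] at h1
    refine h1.congr (.of_forall fun x => ?_)
    have hx : ‖(x : Euc N)‖ ≠ 0 := norm_ne_zero_iff.2 x.2
    simp [smul_smul, hx]
  have hradial : ∀ f : Euc N → ℝ, ∀ ω : Euc N,
      Integrable (fun r : Ioi (0 : ℝ) => f ((r : ℝ) • ω)) (Measure.volumeIoiPow (N - 1)) →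
      IntegrableOn (fun r : ℝ => r ^ (N - 1) * f (r • ω)) (Ioi 0) := by
    intro f ω hf
    rw [Measure.volumeIoiPow, integrable_withDensity_iff_integrable_smul' (by fun_prop)
      (by simp)] at hf
    rw [integrableOn_iff_comap_subtypeVal measurableSet_Ioi]
    refine hf.congr (.of_forall ?_)
    rintro ⟨r, hr : 0 < r⟩
    simp [ENNReal.toReal_ofReal, pow_nonneg hr.le]
  have hint : ∫ x, h x = ∫ p : Metric.sphere (0 : Euc N) 1 × Ioi (0 : ℝ),
      h ((p.2 : ℝ) • (p.1 : Euc N)) ∂(μ.toSphere.prod (Measure.volumeIoiPow (N - 1))) := by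
    rw [← hmp.integral_comp hemb, ← restrict_compl_singleton (μ := volume) (0 : Euc N),
      ← integral_subtype_comap (measurableSet_singleton _).compl]
    refine integral_congr_ae (.of_forall fun x => ?_)
    have hx : ‖(x : Euc N)‖ ≠ 0 := norm_ne_zero_iff.2 x.2
    simp [smul_smul, hx]
  rw [hint, integral_prod _ (hpolar h hh)]
  refine integral_nonneg_of_ae ?_
  filter_upwards [(hpolar h hh).prod_right_ae, (hpolar k hk).prod_right_ae] with ω h1 h2
  have key := H ω (by simp) (hradial h ω h1) (hradial k ω h2)
  refine key.trans_eq (Eq.symm ?_)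
  simp only [Measure.volumeIoiPow, ENNReal.ofReal]
  rw [integral_withDensity_eq_integral_smul (by fun_prop),
    integral_subtype_comap measurableSet_Ioi
      fun r : ℝ => Real.toNNReal (r ^ (N - 1)) • h (r • (ω : Euc N))]
  refine setIntegral_congr_fun measurableSet_Ioi fun r hr => ?_
  simp only [NNReal.smul_def, smul_eq_mul]
  rw [Real.coe_toNNReal _ (pow_nonneg (le_of_lt hr) _)]

/-- The boundary flux in the one-dimensional weighted Hardy inequality. -/
def radialFlux (m : ℕ) (u : ℝ → ℝ) (r : ℝ) : ℝ :=
  -((((m : ℝ) + 1) / 2 * r ^ (m + 1) + r ^ (m + 3) / 2) * Real.exp (r ^ 2 / 4) * u r ^ 2)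

lemma hasDerivAt_radialFlux (m : ℕ) {u : ℝ → ℝ} {u' r : ℝ} (hu : HasDerivAt u u' r) :
    HasDerivAt (radialFlux m u)
      (-(((((m : ℝ) + 1) / 2 * ((m + 1) * r ^ m) + (m + 3) * r ^ (m + 2) / 2) +
          (((m : ℝ) + 1) / 2 * r ^ (m + 1) + r ^ (m + 3) / 2) * (r / 2)) *
          Real.exp (r ^ 2 / 4) * u r ^ 2 +
        (((m : ℝ) + 1) / 2 * r ^ (m + 1) + r ^ (m + 3) / 2) * Real.exp (r ^ 2 / 4) *
          (2 * u r * u'))) r := by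
  have h1 := ((hasDerivAt_pow (m + 1) r).const_mul (((m : ℝ) + 1) / 2)).add
    ((hasDerivAt_pow (m + 3) r).div_const 2)
  have h2 := ((hasDerivAt_pow 2 r).div_const 4).exp
  have h3 := ((h1.mul h2).mul (hu.pow 2)).neg
  refine h3.congr_deriv ?_
  simp only [Pi.add_apply, Pi.mul_apply, Pi.pow_apply]
  push_cast
  ring

lemma deriv_radialFlux_le {m : ℕ} {μ u u' g r : ℝ} (hr : 0 < r)
    (hμ : μ ≤ ((m : ℝ) + 1) ^ 2 / 8) (hg : u' ^ 2 ≤ g) :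
    -(((((m : ℝ) + 1) / 2 * ((m + 1) * r ^ m) + (m + 3) * r ^ (m + 2) / 2) +
          (((m : ℝ) + 1) / 2 * r ^ (m + 1) + r ^ (m + 3) / 2) * (r / 2)) *
          Real.exp (r ^ 2 / 4) * u ^ 2 +
        (((m : ℝ) + 1) / 2 * r ^ (m + 1) + r ^ (m + 3) / 2) * Real.exp (r ^ 2 / 4) *
          (2 * u * u')) ≤
      r ^ (m + 2) * ((g - μ * u ^ 2 / r ^ 2 - ((m : ℝ) + 2) / 4 * u ^ 2) *
        Real.exp (r ^ 2 / 4)) := by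
  rw [← sub_nonneg]
  have h : 0 ≤ (r ^ m * Real.exp (r ^ 2 / 4)) * (r ^ 2 * (g - u' ^ 2) +
      (r * u' + (((m : ℝ) + 1) / 2 + r ^ 2 / 2) * u) ^ 2 +
      u ^ 2 * (((m : ℝ) + 1) ^ 2 / 8 - μ + (((m : ℝ) + 1) ^ 2 / 8 + 3 / 4 * r ^ 2))) := by
    have h1 := sub_nonneg.2 hg
    have h2 := sub_nonneg.2 hμ
    positivity
  refine h.trans_eq ?_
  field_simp
  ring

/-- Weighted Hardy–Poincaré inequality on a ray. -/
lemma radial_integral_nonneg {m : ℕ} {μ : ℝ} (hμ : μ ≤ ((m : ℝ) + 1) ^ 2 / 8)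
    {u u' g : ℝ → ℝ} (hu : ∀ r, HasDerivAt u (u' r) r) (hg : ∀ r, u' r ^ 2 ≤ g r)
    (hint : IntegrableOn (fun r => r ^ (m + 2) *
      ((g r - μ * u r ^ 2 / r ^ 2 - ((m : ℝ) + 2) / 4 * u r ^ 2) * Real.exp (r ^ 2 / 4))) (Ioi 0))
    (hsq : IntegrableOn (fun r => r ^ (m + 2) * (u r ^ 2 * Real.exp (r ^ 2 / 4))) (Ioi 0)) :
    0 ≤ ∫ r in Ioi (0 : ℝ), r ^ (m + 2) *
      ((g r - μ * u r ^ 2 / r ^ 2 - ((m : ℝ) + 2) / 4 * u r ^ 2) * Real.exp (r ^ 2 / 4)) := by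
  set φ : ℝ → ℝ := fun r => r ^ (m + 2) *
      ((g r - μ * u r ^ 2 / r ^ 2 - ((m : ℝ) + 2) / 4 * u r ^ 2) * Real.exp (r ^ 2 / 4))
  by_contra! hneg
  have hflux : ∀ R, 0 ≤ R → radialFlux m u R ≤ ∫ r in (0 : ℝ)..R, φ r := by
    intro R hR
    have h := intervalIntegral.sub_le_integral_of_hasDeriv_right_of_le hR
      (fun r _ => (hasDerivAt_radialFlux m (hu r)).continuousAt.continuousWithinAt)
      (fun r _ => (hasDerivAt_radialFlux m (hu r)).hasDerivWithinAt)
      (φ := φ) ((integrableOn_Icc_iff_integrableOn_Ioc (by simp)).2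
        (hint.mono_set Ioc_subset_Ioi_self))
      (fun r hr => deriv_radialFlux_le hr.1 hμ (hg r))
    simpa [radialFlux] using h
  set c : ℝ := (∫ r in Ioi (0 : ℝ), φ r) / 2 with hc
  have hlim := intervalIntegral_tendsto_integral_Ioi 0 hint Filter.tendsto_id
  have hev : ∀ᶠ R : ℝ in Filter.atTop, ∫ r in (0 : ℝ)..R, φ r < c :=
    hlim.eventually_lt_const (by linarith)
  obtain ⟨R₀, hR₀⟩ := Filter.eventually_atTop.1 (hev.and (Filter.eventually_ge_atTop ((m : ℝ) + 1)))
  have hpos : ∀ r ≥ R₀, (m : ℝ) + 1 ≤ r := fun r hr => (hR₀ r hr).2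
  have hbound : ∀ r ∈ Ioi R₀, -c * r⁻¹ ≤ r ^ (m + 2) * (u r ^ 2 * Real.exp (r ^ 2 / 4)) := by
    intro r hr
    have hmr := hpos r (le_of_lt hr)
    have hm0 : (0 : ℝ) ≤ m := m.cast_nonneg
    have hr1 : 1 ≤ r := by linarith
    have hr0 : 0 < r := by linarith
    have h1 := (hflux r hr0.le).trans (hR₀ r (le_of_lt hr)).1.le
    rw [← div_eq_mul_inv, div_le_iff₀ hr0]
    have h2 : ((m : ℝ) + 1) / 2 * r ^ (m + 1) + r ^ (m + 3) / 2 ≤ r ^ (m + 3) := by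
      have : ((m : ℝ) + 1) * r ^ (m + 1) ≤ r ^ 2 * r ^ (m + 1) := by
        gcongr
        nlinarith
      have e : r ^ (m + 3) = r ^ 2 * r ^ (m + 1) := by ring
      linarith
    have h3 := mul_le_mul_of_nonneg_right h2
      (by positivity : 0 ≤ Real.exp (r ^ 2 / 4) * u r ^ 2)
    have e : r ^ (m + 2) * (u r ^ 2 * Real.exp (r ^ 2 / 4)) * r =
        r ^ (m + 3) * (Real.exp (r ^ 2 / 4) * u r ^ 2) := by ring
    rw [e]
    unfold radialFlux at h1
    linarith
  have hcpos : 0 < -c := by linarith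
  have hR₀pos : 0 ≤ R₀ := le_trans (by positivity) (hpos R₀ le_rfl)
  have hinv : IntegrableOn (fun r : ℝ => -c * r⁻¹) (Ioi R₀) := by
    refine Integrable.mono' (hsq.mono_set (Ioi_subset_Ioi hR₀pos))
      (by fun_prop) ?_
    filter_upwards [ae_restrict_mem measurableSet_Ioi] with r hr
    have hr0 : 0 < r := hR₀pos.trans_lt hr
    rw [Real.norm_of_nonneg (by positivity)]
    exact hbound r hr
  refine not_integrableOn_Ioi_inv (a := R₀) ?_
  have h := hinv.const_mul (-c)⁻¹
  refine h.congr (.of_forall fun r => ?_)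
  exact inv_mul_cancel_left₀ (ne_of_gt hcpos) _

/-- A(v) ≥ (1/4)∫ v² K. -/
theorem A_ge_quarter_L2K (N : ℕ) (hN : 3 ≤ N) (μ : ℝ)
    (hμ : μ ∈ Set.Icc (0 : ℝ) (((N : ℝ) - 2) ^ 2 / 8))
    (v : Euc N → ℝ) (hv : MemX v) :
    (1 / 4) * ∫ x : Euc N, v x ^ 2 * Kw x ≤ Afun μ v := by
  obtain ⟨m, rfl⟩ := Nat.exists_eq_add_of_le' hN
  have hcast : ((m + 3 : ℕ) : ℝ) = m + 3 := by push_cast; ring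
  have hμ' : μ ≤ ((m : ℝ) + 1) ^ 2 / 8 := by
    have := hμ.2
    rw [hcast] at this
    linarith
  set h : Euc (m + 3) → ℝ := fun x =>
    (‖gradient v x‖ ^ 2 - μ * v x ^ 2 / ‖x‖ ^ 2 - ((m : ℝ) + 2) / 4 * v x ^ 2) * Kw x with hh
  have hA : Integrable fun x : Euc (m + 3) => (‖gradient v x‖ ^ 2 - μ * v x ^ 2 / ‖x‖ ^ 2 -
      (((m + 3 : ℕ) : ℝ) - 2) / 4 * v x ^ 2) * Kw x := by
    refine ((hv.int_grad.sub (hv.int_hardy.const_mul μ)).sub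
      (hv.int_sq.const_mul ((((m + 3 : ℕ) : ℝ) - 2) / 4))).congr (.of_forall fun x => ?_)
    simp only [Pi.sub_apply]
    ring
  have hsub : ∀ x, (‖gradient v x‖ ^ 2 - μ * v x ^ 2 / ‖x‖ ^ 2 -
      (((m + 3 : ℕ) : ℝ) - 2) / 4 * v x ^ 2) * Kw x - 1 / 4 * (v x ^ 2 * Kw x) = h x := by
    intro x
    simp only [hh, hcast]
    ring
  have hhint : Integrable h :=
    (hA.sub (hv.int_sq.const_mul (1 / 4))).congr (.of_forall hsub)
  rw [← integral_const_mul, Afun, ← sub_nonneg, ← integral_sub hA (hv.int_sq.const_mul _)]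
  simp only [hsub]
  refine integral_nonneg_of_rays (by omega) hhint hv.int_sq fun ω hω h1 h2 => ?_
  have hK : ∀ r : ℝ, Kw (r • ω) = Real.exp (r ^ 2 / 4) := by
    intro r
    simp [Kw, norm_smul, hω]
  have hnorm : ∀ r : ℝ, ‖r • ω‖ ^ 2 = r ^ 2 := by
    intro r
    simp [norm_smul, hω]
  have hderiv : ∀ r : ℝ, HasDerivAt (fun r : ℝ => v (r • ω))
      (inner ℝ (gradient v (r • ω)) ω) r := by
    intro r
    have hd := (hv.diff (r • ω)).hasGradientAt.hasFDerivAt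
    have hl : HasDerivAt (fun r : ℝ => r • ω) ω r := by
      simpa using (hasDerivAt_id r).smul_const ω
    exact (hd.comp_hasDerivAt r hl).congr_deriv (by simp)
  have hle : ∀ r : ℝ, (inner ℝ (gradient v (r • ω)) ω) ^ 2 ≤ ‖gradient v (r • ω)‖ ^ 2 := by
    intro r
    have := abs_real_inner_le_norm (gradient v (r • ω)) ω
    rw [hω, mul_one] at this
    exact sq_le_sq' (neg_le_of_abs_le this) (le_of_abs_le this)
  simp only [hh, hK, hnorm, show m + 3 - 1 = m + 2 from rfl] at h1 h2 ⊢
  exact radial_integral_nonneg hμ' hderiv hle h1 h2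
end
end

section
/- Let N ≥ 3, K(y) = exp(|y|²/4), 2* = 2N/(N−2), p = 2*−1, β = (N−2)/4, μ ∈ [0, (N−2)²/8]. Let d = d(1) be the depth of the potential well and suppose v ∈ X satisfies 0 < E_K(v) < d. Let δ₁ < 1 < δ₂ be the two roots of the equation d(δ) = E_K(v). Then D_{K,δ}(v) ≠ 0 for every δ ∈ (δ₁, δ₂); consequently the sign of D_{K,δ}(v) does not change as δ ranges over (δ₁, δ₂). -/
open MeasureTheory Real Set

noncomputable section

lemma gradient_const_mul {N : ℕ} (c : ℝ) {v : Euc N → ℝ} (hv : Differentiable ℝ v) (x : Euc N) :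
    gradient (fun y => c * v y) x = c • gradient v x := by
  simp [gradient, fderiv_const_mul (hv x)]

lemma two_lt_twoStar {N : ℕ} (hN : 3 ≤ N) : 2 < twoStar N := by
  have h : (3 : ℝ) ≤ N := by exact_mod_cast hN
  rw [twoStar, lt_div_iff₀ (by linarith)]
  linarith

lemma Bfun_nonneg {N : ℕ} (v : Euc N → ℝ) : 0 ≤ Bfun v :=
  integral_nonneg fun _ => mul_nonneg (rpow_nonneg (abs_nonneg _) _) (exp_pos _).le

lemma Bfun_const_mul {N : ℕ} {c : ℝ} (hc : 0 ≤ c) (v : Euc N → ℝ) :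
    Bfun (fun y => c * v y) = c ^ twoStar N * Bfun v := by
  simp_rw [Bfun, abs_mul, abs_of_nonneg hc, mul_rpow hc (abs_nonneg _), mul_assoc]
  exact integral_const_mul _ _

lemma Afun_const_mul {N : ℕ} (μ c : ℝ) {v : Euc N → ℝ} (hv : Differentiable ℝ v) :
    Afun μ (fun y => c * v y) = c ^ 2 * Afun μ v := by
  simp_rw [Afun, gradient_const_mul c hv, norm_smul]
  rw [← integral_const_mul]
  congr 1 with x
  rw [mul_pow, Real.norm_eq_abs, sq_abs]
  ring

lemma gradNormSq_const_mul {N : ℕ} (c : ℝ) {v : Euc N → ℝ} (hv : Differentiable ℝ v) :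
    gradNormSq (fun y => c * v y) = c ^ 2 * gradNormSq v := by
  simp_rw [gradNormSq, gradient_const_mul c hv, norm_smul, mul_pow, Real.norm_eq_abs, sq_abs,
    mul_assoc]
  exact integral_const_mul _ _

lemma MemX.const_mul {N : ℕ} {v : Euc N → ℝ} (hv : MemX v) {c : ℝ} (hc : 0 ≤ c) :
    MemX fun y => c * v y where
  diff := hv.diff.const_mul c
  int_grad := by
    simpa only [gradient_const_mul c hv.diff, norm_smul, mul_pow, mul_assoc]
      using hv.int_grad.const_mul (‖c‖ ^ 2)
  int_sq := by
    simpa only [mul_pow, mul_assoc] using hv.int_sq.const_mul (c ^ 2)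
  int_hardy := by
    simpa only [mul_pow, mul_assoc, mul_div_assoc] using hv.int_hardy.const_mul (c ^ 2)
  int_crit := by
    simpa only [abs_mul, abs_of_nonneg hc, mul_rpow hc (abs_nonneg _), mul_assoc]
      using hv.int_crit.const_mul (c ^ twoStar N)

lemma MemX.Afun_le_gradNormSq {N : ℕ} (hN : 2 ≤ N) {μ : ℝ} (hμ : 0 ≤ μ) {v : Euc N → ℝ}
    (hv : MemX v) : Afun μ v ≤ gradNormSq v := by
  have hN' : (2 : ℝ) ≤ N := by exact_mod_cast hN
  have hint : Integrable fun x =>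
      (‖gradient v x‖ ^ 2 - μ * v x ^ 2 / ‖x‖ ^ 2 - ((N : ℝ) - 2) / 4 * v x ^ 2) * Kw x := by
    refine ((hv.int_grad.sub (hv.int_hardy.const_mul μ)).sub
      (hv.int_sq.const_mul (((N : ℝ) - 2) / 4))).congr (.of_forall fun x => ?_)
    simp only [Pi.sub_apply]
    ring
  refine integral_mono hint hv.int_grad fun x => ?_
  refine mul_le_mul_of_nonneg_right ?_ (exp_pos _).le
  have h₁ : 0 ≤ μ * v x ^ 2 / ‖x‖ ^ 2 := by positivity
  have h₂ : 0 ≤ ((N : ℝ) - 2) / 4 * v x ^ 2 := mul_nonneg (by linarith) (sq_nonneg _)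
  linarith

lemma MemX.eq_zero_of_Bfun_eq_zero {N : ℕ} (hN : 3 ≤ N) {v : Euc N → ℝ} (hv : MemX v)
    (hB : Bfun v = 0) : v = 0 := by
  have hs := two_lt_twoStar hN
  have hae := (integral_eq_zero_iff_of_nonneg
    (fun x => mul_nonneg (rpow_nonneg (abs_nonneg _) _) (exp_pos _).le) hv.int_crit).1 hB
  refine (Continuous.ae_eq_iff_eq volume hv.diff.continuous continuous_const).1 ?_
  filter_upwards [hae] with x hx
  have h := (mul_eq_zero.1 hx).resolve_right (exp_pos _).ne'
  exact abs_eq_zero.1 ((rpow_eq_zero (abs_nonneg _) (by linarith)).1 h)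

lemma ddepth_nonpos {N : ℕ} (hN : 3 ≤ N) (μ : ℝ) {δ : ℝ} (hδ : δ ≤ 0) : ddepth N μ δ ≤ 0 := by
  have hs := two_lt_twoStar hN
  refine Real.sInf_nonpos ?_
  rintro _ ⟨w, hw, hD, hg, rfl⟩
  have hB := Bfun_nonneg w
  have hBs : 0 ≤ Bfun w / twoStar N := div_nonneg hB (by linarith)
  have hne : Bfun w ≠ 0 := fun h => hg <| by
    simp [hw.eq_zero_of_Bfun_eq_zero hN h, gradNormSq, gradient]
  have hpos := hB.lt_of_ne' hne
  unfold DKd at hD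
  unfold EKf
  have hA : Afun μ w ≤ 0 := by
    by_contra! h
    nlinarith [mul_nonneg (neg_nonneg.2 hδ) h.le]
  linarith

lemma ddepth_le_EKf {N : ℕ} {μ δ : ℝ} (hd : ddepth N μ δ ≠ 0) {w : Euc N → ℝ} (hw : MemX w)
    (hD : DKd μ δ w = 0) (hg : gradNormSq w ≠ 0) : ddepth N μ δ ≤ EKf μ w := by
  refine csInf_le ?_ ⟨w, hw, hD, hg, rfl⟩
  by_contra h
  exact hd (Real.sInf_of_not_bddBelow h)

/-- Along the ray through a function with `D_{K,δ} = 0`, the energy at the point of the ray lying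
on the manifold with a parameter `δ'` further away from `1` is strictly smaller. -/
lemma ddepth_lt_EKf {N : ℕ} (hN : 3 ≤ N) {μ δ δ' : ℝ} (hμ : 0 ≤ μ) {v : Euc N → ℝ}
    (hv : MemX v) (hA : 0 < Afun μ v) (hD : DKd μ δ v = 0) (hδ' : 0 < δ') (hδ : 0 < δ)
    (hlt : δ' < δ ∧ δ ≤ 1 ∨ 1 ≤ δ ∧ δ < δ') (hd : ddepth N μ δ' ≠ 0) :
    ddepth N μ δ' < EKf μ v := by
  have hs := two_lt_twoStar hN
  have hs₂ : 0 < twoStar N - 2 := by linarith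
  have hB : Bfun v = δ * Afun μ v := by unfold DKd at hD; linarith
  set s := twoStar N with hs_def
  set c : ℝ := (δ' / δ) ^ (1 / (s - 2)) with hc_def
  have hq : 0 < δ' / δ := div_pos hδ' hδ
  have hc : 0 < c := rpow_pos_of_pos hq _
  have hcs : c ^ s = c ^ 2 * (δ' / δ) := by
    have h : c ^ (s - 2) = δ' / δ := by
      rw [hc_def, ← rpow_mul hq.le, one_div_mul_cancel hs₂.ne', rpow_one]
    rw [← h, ← rpow_natCast c 2, ← rpow_add hc]
    congr 1
    push_cast
    ring
  have hgrad : gradNormSq v ≠ 0 := (hA.trans_le (hv.Afun_le_gradNormSq (by omega) hμ)).ne'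
  have hle : ddepth N μ δ' ≤ EKf μ fun y => c * v y := by
    refine ddepth_le_EKf hd (hv.const_mul hc.le) ?_ ?_
    · rw [DKd, Afun_const_mul μ c hv.diff, Bfun_const_mul hc.le, ← hs_def, hcs, hB]
      field_simp
      ring
    · rw [gradNormSq_const_mul c hv.diff]
      exact mul_ne_zero (pow_ne_zero 2 hc.ne') hgrad
  refine hle.trans_lt ?_
  have hbern : c ≠ 1 → 1 + s / 2 * (c ^ 2 - 1) < c ^ s := fun hc1 => by
    have h := one_add_mul_self_lt_rpow_one_add (s := c ^ 2 - 1) (by nlinarith [sq_nonneg c])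
      (fun h => hc1 (by nlinarith)) (p := s / 2) (by linarith)
    rwa [add_sub_cancel, ← rpow_natCast c 2, ← rpow_mul hc.le, Nat.cast_ofNat,
      mul_div_cancel₀ _ (two_ne_zero' ℝ), rpow_ofNat] at h
  have hkey : (c ^ 2 - 1) * (s / 2) < δ * (c ^ s - 1) := by
    rcases hlt with ⟨h, h1⟩ | ⟨h1, h⟩
    · have hc1 : c < 1 := rpow_lt_one hq.le ((div_lt_one hδ).2 h) (by positivity)
      have hb := mul_lt_mul_of_pos_left (hbern hc1.ne) hδ
      have hx : c ^ 2 - 1 ≤ 0 := by nlinarith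
      nlinarith [mul_nonneg (mul_nonneg (sub_nonneg.2 h1) (neg_nonneg.2 hx)) hs₂.le,
        mul_nonneg (sub_nonneg.2 h1) (neg_nonneg.2 hx)]
    · have hc1 : 1 < c := one_lt_rpow ((one_lt_div hδ).2 h) (by positivity)
      have hb := mul_lt_mul_of_pos_left (hbern hc1.ne') hδ
      have hx : 0 ≤ c ^ 2 - 1 := by nlinarith
      nlinarith [mul_nonneg (mul_nonneg (sub_nonneg.2 h1) hx) hs₂.le,
        mul_nonneg (sub_nonneg.2 h1) hx]
  rw [EKf, EKf, Afun_const_mul μ c hv.diff, Bfun_const_mul hc.le, ← hs_def, hB, ← sub_pos]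
  have heq : Afun μ v / 2 - δ * Afun μ v / s -
      (c ^ 2 * Afun μ v / 2 - c ^ s * (δ * Afun μ v) / s) =
      Afun μ v / s * (δ * (c ^ s - 1) - (c ^ 2 - 1) * (s / 2)) := by
    field_simp
    ring
  rw [heq]
  exact mul_pos (div_pos hA (by linarith)) (sub_pos.2 hkey)

/-- if 0 < E_K(v) < d and δ₁ < 1 < δ₂ are roots of d(δ) = E_K(v),
then D_{K,δ}(v) ≠ 0 on (δ₁,δ₂), so its sign does not change there. -/
theorem DKd_sign_unchanged (N : ℕ) (hN : 3 ≤ N) (μ : ℝ)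
    (hμ : μ ∈ Set.Icc (0 : ℝ) (((N : ℝ) - 2) ^ 2 / 8))
    (v : Euc N → ℝ) (hv : MemX v)
    (hE0 : 0 < EKf μ v) (hEd : EKf μ v < ddepth N μ 1)
    (δ₁ δ₂ : ℝ) (h1 : δ₁ < 1) (h2 : 1 < δ₂)
    (hroot1 : ddepth N μ δ₁ = EKf μ v) (hroot2 : ddepth N μ δ₂ = EKf μ v) :
    (∀ δ ∈ Set.Ioo δ₁ δ₂, DKd μ δ v ≠ 0) ∧
    ((∀ δ ∈ Set.Ioo δ₁ δ₂, 0 < DKd μ δ v) ∨ (∀ δ ∈ Set.Ioo δ₁ δ₂, DKd μ δ v < 0)) := by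
  have hδ₁ : 0 < δ₁ := by
    by_contra! h
    linarith [ddepth_nonpos hN μ h]
  have hne : ∀ δ ∈ Set.Ioo δ₁ δ₂, DKd μ δ v ≠ 0 := by
    rintro δ ⟨hl, hr⟩ hD
    have hδ : 0 < δ := hδ₁.trans hl
    have hA : 0 < Afun μ v := by
      have hB : 0 ≤ Bfun v / twoStar N :=
        div_nonneg (Bfun_nonneg v) (by linarith [two_lt_twoStar hN])
      unfold EKf at hE0
      linarith
    rcases le_total δ 1 with h | h
    · exact (ddepth_lt_EKf hN hμ.1 hv hA hD hδ₁ hδ (.inl ⟨hl, h⟩) (by linarith)).ne hroot1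
    · exact (ddepth_lt_EKf hN hμ.1 hv hA hD (by linarith) hδ (.inr ⟨h, hr⟩)
        (by linarith)).ne hroot2
  refine ⟨hne, ?_⟩
  have hcont : ContinuousOn (fun δ => DKd μ δ v) (Set.Ioo δ₁ δ₂) := by
    unfold DKd
    fun_prop
  by_contra! h
  obtain ⟨⟨a, ha, hle⟩, b, hb, hge⟩ := h
  obtain ⟨δ, hδ, h0⟩ := isPreconnected_Ioo.intermediate_value ha hb hcont ⟨hle, hge⟩
  exact hne δ hδ h0
end
end
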